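/- Let H be a class of continuous multilinear operators between Banach spaces satisfying the hyper-ideal property and such that each component H(E1,…,En;F) is a linear subspace of L(E1,…,En;F). Then H contains all multilinear operators of finite type if and only if H contains all finite-rank continuous multilinear operators. -/

import Mathlib

open Filter Topology
open scoped ENNReal NNReal BigOperators

noncomputable section

/-- The type of classes of continuous multilinear operators between Banach spaces:
one set of continuous `n`-linear operators for each `n` and each tuple of Banach spaces
`E₁, …, Eₙ, F` over `𝕜`. -/
abbrev MultiClass (𝕜 : Type) [RCLike 𝕜] : Type 1 :=
  ∀ (n : ℕ) (E : Fin n → Type) [∀ i, NormedAddCommGroup (E i)] [∀ i, NormedSpace 𝕜 (E i)]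
    [∀ i, CompleteSpace (E i)]
    (F : Type) [NormedAddCommGroup F] [NormedSpace 𝕜 F] [CompleteSpace F],
    Set (ContinuousMultilinearMap 𝕜 E F)

/-- A real-valued "norm" function defined on all continuous multilinear operators
between Banach spaces. -/
abbrev MultiNorm (𝕜 : Type) [RCLike 𝕜] : Type 1 :=
  ∀ (n : ℕ) (E : Fin n → Type) [∀ i, NormedAddCommGroup (E i)] [∀ i, NormedSpace 𝕜 (E i)]
    [∀ i, CompleteSpace (E i)]
    (F : Type) [NormedAddCommGroup F] [NormedSpace 𝕜 F] [CompleteSpace F],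
    ContinuousMultilinearMap 𝕜 E F → ℝ

variable (𝕜 : Type) [RCLike 𝕜]

/-- The finite type multilinear operators: the linear span of the operators
`(x₁,…,xₙ) ↦ φ₁(x₁)⋯φₙ(xₙ) • y` with `φᵢ ∈ Eᵢ'`, `y ∈ F`. -/
def IsFiniteType {n : ℕ} {E : Fin n → Type} [∀ i, NormedAddCommGroup (E i)]
    [∀ i, NormedSpace 𝕜 (E i)] {F : Type} [NormedAddCommGroup F] [NormedSpace 𝕜 F]
    (A : ContinuousMultilinearMap 𝕜 E F) : Prop :=
  A ∈ Submodule.span 𝕜 {B : ContinuousMultilinearMap 𝕜 E F |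
      ∃ (φ : ∀ i, E i →L[𝕜] 𝕜) (y : F), ∀ x, B x = (∏ i, φ i (x i)) • y}

/-- A multilinear operator has finite rank if its range spans a finite-dimensional
subspace of the target space. -/
def IsFiniteRank {n : ℕ} {E : Fin n → Type} [∀ i, NormedAddCommGroup (E i)]
    [∀ i, NormedSpace 𝕜 (E i)] {F : Type} [NormedAddCommGroup F] [NormedSpace 𝕜 F]
    (A : ContinuousMultilinearMap 𝕜 E F) : Prop :=
  FiniteDimensional 𝕜 (Submodule.span 𝕜 (Set.range (⇑A)))

/-- `IsBlockComp 𝕜 f B A t C` says that `C = t ∘ A ∘ (B₁,…,Bₙ)`, where the blocks of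
variables `(G₁,…,G_{m₁}), (G_{m₁+1},…,G_{m₂}), …` are the fibers of the monotone
surjection `f : Fin M → Fin n` (this encodes naturals `1 ≤ m₁ < ⋯ < mₙ = M`). -/
def IsBlockComp {n M : ℕ} {G : Fin M → Type} [∀ j, NormedAddCommGroup (G j)]
    [∀ j, NormedSpace 𝕜 (G j)] {E : Fin n → Type} [∀ i, NormedAddCommGroup (E i)]
    [∀ i, NormedSpace 𝕜 (E i)] {F H0 : Type} [NormedAddCommGroup F] [NormedSpace 𝕜 F]
    [NormedAddCommGroup H0] [NormedSpace 𝕜 H0]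
    (f : Fin M → Fin n)
    (B : ∀ i : Fin n, ContinuousMultilinearMap 𝕜 (fun j : {j : Fin M // f j = i} => G j.1) (E i))
    (A : ContinuousMultilinearMap 𝕜 E F) (t : F →L[𝕜] H0)
    (C : ContinuousMultilinearMap 𝕜 G H0) : Prop :=
  ∀ x : ∀ j, G j, C x = t (A fun i => B i fun j => x j.1)

/-- All the hyper-ideal axioms except for the containment of the finite type operators:
each component is a linear subspace, and the class enjoys the hyper-ideal property. -/
structure IsHyperIdealCore (H : MultiClass 𝕜) : Prop where
  zero_mem : ∀ (n : ℕ) (E : Fin n → Type) [∀ i, NormedAddCommGroup (E i)]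
      [∀ i, NormedSpace 𝕜 (E i)] [∀ i, CompleteSpace (E i)]
      (F : Type) [NormedAddCommGroup F] [NormedSpace 𝕜 F] [CompleteSpace F],
      (0 : ContinuousMultilinearMap 𝕜 E F) ∈ H n E F
  add_mem : ∀ (n : ℕ) (E : Fin n → Type) [∀ i, NormedAddCommGroup (E i)]
      [∀ i, NormedSpace 𝕜 (E i)] [∀ i, CompleteSpace (E i)]
      (F : Type) [NormedAddCommGroup F] [NormedSpace 𝕜 F] [CompleteSpace F]
      {A B : ContinuousMultilinearMap 𝕜 E F},
      A ∈ H n E F → B ∈ H n E F → A + B ∈ H n E F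
  smul_mem : ∀ (n : ℕ) (E : Fin n → Type) [∀ i, NormedAddCommGroup (E i)]
      [∀ i, NormedSpace 𝕜 (E i)] [∀ i, CompleteSpace (E i)]
      (F : Type) [NormedAddCommGroup F] [NormedSpace 𝕜 F] [CompleteSpace F]
      (c : 𝕜) {A : ContinuousMultilinearMap 𝕜 E F},
      A ∈ H n E F → c • A ∈ H n E F
  comp_mem : ∀ (n M : ℕ) (G : Fin M → Type) [∀ j, NormedAddCommGroup (G j)]
      [∀ j, NormedSpace 𝕜 (G j)] [∀ j, CompleteSpace (G j)]
      (E : Fin n → Type) [∀ i, NormedAddCommGroup (E i)] [∀ i, NormedSpace 𝕜 (E i)]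
      [∀ i, CompleteSpace (E i)]
      (F H0 : Type) [NormedAddCommGroup F] [NormedSpace 𝕜 F] [CompleteSpace F]
      [NormedAddCommGroup H0] [NormedSpace 𝕜 H0] [CompleteSpace H0]
      (f : Fin M → Fin n), Monotone f → Function.Surjective f →
      ∀ (B : ∀ i : Fin n, ContinuousMultilinearMap 𝕜 (fun j : {j : Fin M // f j = i} => G j.1) (E i))
        (A : ContinuousMultilinearMap 𝕜 E F), A ∈ H n E F →
      ∀ (t : F →L[𝕜] H0) (C : ContinuousMultilinearMap 𝕜 G H0),
        IsBlockComp 𝕜 f B A t C → C ∈ H M G H0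

/-- A hyper-ideal of multilinear operators. -/
structure IsHyperIdeal (H : MultiClass 𝕜) extends IsHyperIdealCore 𝕜 H : Prop where
  finiteType_mem : ∀ (n : ℕ) (E : Fin n → Type) [∀ i, NormedAddCommGroup (E i)]
      [∀ i, NormedSpace 𝕜 (E i)] [∀ i, CompleteSpace (E i)]
      (F : Type) [NormedAddCommGroup F] [NormedSpace 𝕜 F] [CompleteSpace F]
      (A : ContinuousMultilinearMap 𝕜 E F), IsFiniteType 𝕜 A → A ∈ H n E F

/-- A `p`-normed hyper-ideal `(H, N)`. -/
structure IsPNormedHyperIdeal (H : MultiClass 𝕜) (N : MultiNorm 𝕜) (p : ℝ)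
    extends IsHyperIdeal 𝕜 H : Prop where
  p_pos : 0 < p
  p_le_one : p ≤ 1
  norm_nonneg' : ∀ (n : ℕ) (E : Fin n → Type) [∀ i, NormedAddCommGroup (E i)]
      [∀ i, NormedSpace 𝕜 (E i)] [∀ i, CompleteSpace (E i)]
      (F : Type) [NormedAddCommGroup F] [NormedSpace 𝕜 F] [CompleteSpace F]
      (A : ContinuousMultilinearMap 𝕜 E F), 0 ≤ N n E F A
  norm_eq_zero_iff : ∀ (n : ℕ) (E : Fin n → Type) [∀ i, NormedAddCommGroup (E i)]
      [∀ i, NormedSpace 𝕜 (E i)] [∀ i, CompleteSpace (E i)]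
      (F : Type) [NormedAddCommGroup F] [NormedSpace 𝕜 F] [CompleteSpace F]
      {A : ContinuousMultilinearMap 𝕜 E F}, A ∈ H n E F → (N n E F A = 0 ↔ A = 0)
  norm_smul : ∀ (n : ℕ) (E : Fin n → Type) [∀ i, NormedAddCommGroup (E i)]
      [∀ i, NormedSpace 𝕜 (E i)] [∀ i, CompleteSpace (E i)]
      (F : Type) [NormedAddCommGroup F] [NormedSpace 𝕜 F] [CompleteSpace F]
      (c : 𝕜) {A : ContinuousMultilinearMap 𝕜 E F}, A ∈ H n E F →
      N n E F (c • A) = ‖c‖ * N n E F A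
  norm_add_le : ∀ (n : ℕ) (E : Fin n → Type) [∀ i, NormedAddCommGroup (E i)]
      [∀ i, NormedSpace 𝕜 (E i)] [∀ i, CompleteSpace (E i)]
      (F : Type) [NormedAddCommGroup F] [NormedSpace 𝕜 F] [CompleteSpace F]
      {A B : ContinuousMultilinearMap 𝕜 E F}, A ∈ H n E F → B ∈ H n E F →
      N n E F (A + B) ^ p ≤ N n E F A ^ p + N n E F B ^ p
  norm_In : ∀ n : ℕ,
      N n (fun _ => 𝕜) 𝕜 (ContinuousMultilinearMap.mkPiAlgebra 𝕜 (Fin n) 𝕜) = 1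
  norm_comp_le : ∀ (n M : ℕ) (G : Fin M → Type) [∀ j, NormedAddCommGroup (G j)]
      [∀ j, NormedSpace 𝕜 (G j)] [∀ j, CompleteSpace (G j)]
      (E : Fin n → Type) [∀ i, NormedAddCommGroup (E i)] [∀ i, NormedSpace 𝕜 (E i)]
      [∀ i, CompleteSpace (E i)]
      (F H0 : Type) [NormedAddCommGroup F] [NormedSpace 𝕜 F] [CompleteSpace F]
      [NormedAddCommGroup H0] [NormedSpace 𝕜 H0] [CompleteSpace H0]
      (f : Fin M → Fin n), Monotone f → Function.Surjective f →
      ∀ (B : ∀ i : Fin n, ContinuousMultilinearMap 𝕜 (fun j : {j : Fin M // f j = i} => G j.1) (E i))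
        (A : ContinuousMultilinearMap 𝕜 E F), A ∈ H n E F →
      ∀ (t : F →L[𝕜] H0) (C : ContinuousMultilinearMap 𝕜 G H0),
        IsBlockComp 𝕜 f B A t C →
        N M G H0 C ≤ ‖t‖ * N n E F A * ∏ i, ‖B i‖

/-- A `p`-Banach hyper-ideal: a `p`-normed hyper-ideal each of whose components is
complete in the topology generated by the `p`-norm `N`. -/
structure IsPBanachHyperIdeal (H : MultiClass 𝕜) (N : MultiNorm 𝕜) (p : ℝ)
    extends IsPNormedHyperIdeal 𝕜 H N p : Prop where
  complete : ∀ (n : ℕ) (E : Fin n → Type) [∀ i, NormedAddCommGroup (E i)]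
      [∀ i, NormedSpace 𝕜 (E i)] [∀ i, CompleteSpace (E i)]
      (F : Type) [NormedAddCommGroup F] [NormedSpace 𝕜 F] [CompleteSpace F]
      (u : ℕ → ContinuousMultilinearMap 𝕜 E F), (∀ k, u k ∈ H n E F) →
      (∀ ε : ℝ, 0 < ε → ∃ K : ℕ, ∀ k ≥ K, ∀ l ≥ K, N n E F (u k - u l) < ε) →
      ∃ A ∈ H n E F, Tendsto (fun k => N n E F (u k - A)) atTop (𝓝 0)

/-- The uniform (operator) norm, as a `MultiNorm`. -/
def opMultiNorm : MultiNorm 𝕜 := by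
  intro n E _ _ _ F _ _ _
  exact fun A => ‖A‖

theorem update_comp_subtype {ι : Type*} [DecidableEq ι] {E : ι → Type*} {p : ι → Prop}
    [DecidableEq {j // p j}] (hp : ∀ j, p j) (x : ∀ j : {j // p j}, E j.1) (i : {j // p j})
    (u : E i.1) :
    (fun j => Function.update x i u ⟨j, hp j⟩) =
      Function.update (fun j => x ⟨j, hp j⟩) i.1 u := by
  funext j
  obtain ⟨i, hi⟩ := i
  by_cases h : j = i
  · subst h; simp
  · simp [Function.update_of_ne, h]

namespace ContinuousMultilinearMap

variable {𝕜}

/-- Reindexing of a continuous multilinear map along the inclusion of a full subtype. -/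
def domSubtype {n : ℕ} {E : Fin n → Type} [∀ i, NormedAddCommGroup (E i)]
    [∀ i, NormedSpace 𝕜 (E i)] {F : Type} [NormedAddCommGroup F] [NormedSpace 𝕜 F]
    (p : Fin n → Prop) (hp : ∀ j, p j) (A : ContinuousMultilinearMap 𝕜 E F) :
    ContinuousMultilinearMap 𝕜 (fun j : {j // p j} => E j.1) F where
  toFun x := A fun j => x ⟨j, hp j⟩
  map_update_add' := by
    intro _ x i v w
    simp only [update_comp_subtype, map_update_add]
  map_update_smul' := by
    intro _ x i c v
    simp only [update_comp_subtype, map_update_smul]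
  cont := A.cont.comp (continuous_pi fun j => continuous_apply (⟨j, hp j⟩ : {j // p j}))

end ContinuousMultilinearMap

/-- Every operator of finite type has finite rank. -/
theorem IsFiniteType.isFiniteRank {n : ℕ} {E : Fin n → Type} [∀ i, NormedAddCommGroup (E i)]
    [∀ i, NormedSpace 𝕜 (E i)] {F : Type} [NormedAddCommGroup F] [NormedSpace 𝕜 F]
    {A : ContinuousMultilinearMap 𝕜 E F} (hA : IsFiniteType 𝕜 A) : IsFiniteRank 𝕜 A := by
  suffices h : ∃ W : Submodule 𝕜 F, FiniteDimensional 𝕜 W ∧ ∀ x, A x ∈ W by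
    obtain ⟨W, hW, h⟩ := h
    exact Submodule.finiteDimensional_of_le
      (Submodule.span_le.2 (Set.range_subset_iff.2 h) : _ ≤ W)
  unfold IsFiniteType at hA
  induction hA using Submodule.span_induction with
  | mem B hB =>
    obtain ⟨φ, y, h⟩ := hB
    refine ⟨Submodule.span 𝕜 {y}, inferInstance, fun x => ?_⟩
    rw [h]
    exact Submodule.smul_mem _ _ (Submodule.mem_span_singleton_self y)
  | zero => exact ⟨⊥, inferInstance, fun x => by simp⟩
  | add B C _ _ hB hC =>
    obtain ⟨V, hV, hB⟩ := hB
    obtain ⟨W, hW, hC⟩ := hC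
    exact ⟨V ⊔ W, inferInstance, fun x => Submodule.add_mem_sup (hB x) (hC x)⟩
  | smul c B _ hB =>
    obtain ⟨V, hV, hB⟩ := hB
    exact ⟨V, hV, fun x => V.smul_mem c (hB x)⟩

/-- A `0`-linear operator is of finite type. -/
theorem isFiniteType_of_zero {E : Fin 0 → Type} [∀ i, NormedAddCommGroup (E i)]
    [∀ i, NormedSpace 𝕜 (E i)] {F : Type} [NormedAddCommGroup F] [NormedSpace 𝕜 F]
    (A : ContinuousMultilinearMap 𝕜 E F) : IsFiniteType 𝕜 A :=
  Submodule.subset_span ⟨fun _ => 0, A 0, fun x => by simp [Subsingleton.elim x 0]⟩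

/-- The identity of a finite-dimensional space, as a `1`-linear operator, is of finite type. -/
theorem isFiniteType_ofSubsingleton_id (V : Type) [NormedAddCommGroup V] [NormedSpace 𝕜 V]
    [FiniteDimensional 𝕜 V] :
    IsFiniteType 𝕜 (ContinuousMultilinearMap.ofSubsingleton 𝕜 V V (0 : Fin 1)
      (ContinuousLinearMap.id 𝕜 V)) := by
  let b := Module.finBasis 𝕜 V
  have h : ContinuousMultilinearMap.ofSubsingleton 𝕜 V V (0 : Fin 1)
      (ContinuousLinearMap.id 𝕜 V) =
      ∑ k, ContinuousMultilinearMap.ofSubsingleton 𝕜 V V (0 : Fin 1)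
        ((LinearMap.toContinuousLinearMap (b.coord k)).smulRight (b k)) := by
    ext x
    simp [b.sum_repr]
  rw [h]
  refine Submodule.sum_mem _ fun k _ => Submodule.subset_span
    ⟨fun _ => LinearMap.toContinuousLinearMap (b.coord k), b k, fun x => by simp⟩

/-- For a class of continuous multilinear operators whose components are linear
subspaces and which has the hyper-ideal property, containing all finite type operators
is equivalent to containing all finite-rank operators. -/
theorem finiteType_mem_iff_finiteRank_mem (H : MultiClass 𝕜)
    (hH : IsHyperIdealCore 𝕜 H) :
    (∀ (n : ℕ) (E : Fin n → Type) [∀ i, NormedAddCommGroup (E i)]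
      [∀ i, NormedSpace 𝕜 (E i)] [∀ i, CompleteSpace (E i)]
      (F : Type) [NormedAddCommGroup F] [NormedSpace 𝕜 F] [CompleteSpace F]
      (A : ContinuousMultilinearMap 𝕜 E F), IsFiniteType 𝕜 A → A ∈ H n E F) ↔
    (∀ (n : ℕ) (E : Fin n → Type) [∀ i, NormedAddCommGroup (E i)]
      [∀ i, NormedSpace 𝕜 (E i)] [∀ i, CompleteSpace (E i)]
      (F : Type) [NormedAddCommGroup F] [NormedSpace 𝕜 F] [CompleteSpace F]
      (A : ContinuousMultilinearMap 𝕜 E F), IsFiniteRank 𝕜 A → A ∈ H n E F) := by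
  refine ⟨fun h n E _ _ _ F _ _ _ A hA => ?_,
    fun h n E _ _ _ F _ _ _ A hA => h n E F A hA.isFiniteRank⟩
  obtain rfl | hn := Nat.eq_zero_or_pos n
  · exact h 0 E F A (isFiniteType_of_zero 𝕜 A)
  let S := Submodule.span 𝕜 (Set.range A)
  have : FiniteDimensional 𝕜 S := hA
  have : CompleteSpace S := FiniteDimensional.complete 𝕜 S
  let A' : ContinuousMultilinearMap 𝕜 E S :=
    A.codRestrict S fun x => Submodule.subset_span ⟨x, rfl⟩
  exact hH.comp_mem 1 n E (fun _ => S) S F (fun _ => 0) monotone_const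
    (fun i => ⟨⟨0, hn⟩, Subsingleton.elim _ _⟩)
    (fun i => A'.domSubtype _ fun _ => Subsingleton.elim _ _) _
    (h 1 (fun _ => S) S _ (isFiniteType_ofSubsingleton_id 𝕜 S)) S.subtypeL A fun x => rfl

end
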